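/- Let g, d, N, G be real numbers with g > 0, d ≥ g/2, G ≥ 2, G ≥ d/g, and N ≥ (G-1)·g; let I ≥ 0 and let c be a real number with 0 < c ≤ 1/4. Suppose there exist real numbers ε₁, …, ε_G (G a natural number here) with 0 ≤ εᵢ < 1/2 for all i, ∑_{i=1}^G εᵢ ≤ c, and d ≤ ∑_{i=1}^G (I + h₂(εᵢ))/(1 - 2εᵢ). Then N ≥ (d - I/(1-2c)) / ( I/g + (G/(g·(G-1)))·h₂(g·c/d)/(1-2c) ). -/

import Mathlib

/-- The binary entropy function `h₂(x) = -x·log₂ x - (1-x)·log₂(1-x)`,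
with the convention `0·log₂ 0 = 0` (automatic since `Real.logb 2 0 = 0`). -/
noncomputable def binEnt (x : ℝ) : ℝ :=
  -x * Real.logb 2 x - (1 - x) * Real.logb 2 (1 - x)

lemma binEnt_eq_binEntropy_div (x : ℝ) : binEnt x = Real.binEntropy x / Real.log 2 := by
  simp only [binEnt, Real.binEntropy, Real.logb, Real.log_inv]
  ring

lemma binEnt_nonneg {x : ℝ} (h0 : 0 ≤ x) (h1 : x ≤ 1) : 0 ≤ binEnt x := by
  rw [binEnt_eq_binEntropy_div]
  exact div_nonneg (Real.binEntropy_nonneg h0 h1) (Real.log_nonneg one_le_two)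

lemma binEnt_pos {x : ℝ} (h0 : 0 < x) (h1 : x < 1) : 0 < binEnt x := by
  rw [binEnt_eq_binEntropy_div]
  exact div_pos (Real.binEntropy_pos h0 h1) (Real.log_pos one_lt_two)

lemma binEnt_le_binEnt {x y : ℝ} (h0 : 0 ≤ x) (hxy : x ≤ y) (hy : y ≤ 1 / 2) :
    binEnt x ≤ binEnt y := by
  have hy' : y ≤ 2⁻¹ := by linarith
  rw [binEnt_eq_binEntropy_div, binEnt_eq_binEntropy_div]
  exact div_le_div_of_nonneg_right
    (Real.binEntropy_strictMonoOn.monotoneOn ⟨h0, hxy.trans hy'⟩ ⟨h0.trans hxy, hy'⟩ hxy)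
    (Real.log_nonneg one_le_two)

/-- Jensen's inequality for the binary entropy, with uniform weights. -/
lemma sum_binEnt_le {n : ℕ} (hn : 0 < n) (p : Fin n → ℝ) (h0 : ∀ i, 0 ≤ p i)
    (h1 : ∀ i, p i ≤ 1) : ∑ i, binEnt (p i) ≤ n * binEnt ((∑ i, p i) / n) := by
  have hn' : (0 : ℝ) < n := Nat.cast_pos.mpr hn
  have h := Real.strictConcave_binEntropy.concaveOn.le_map_sum (t := Finset.univ)
    (w := fun _ : Fin n => (n : ℝ)⁻¹) (p := p) (fun _ _ => by positivity)
    (by simp [hn'.ne']) (fun i _ => ⟨h0 i, h1 i⟩)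
  simp only [smul_eq_mul, ← Finset.mul_sum] at h
  rw [inv_mul_le_iff₀ hn', inv_mul_eq_div] at h
  simp only [binEnt_eq_binEntropy_div, ← Finset.sum_div]
  rw [← mul_div_assoc]
  exact div_le_div_of_nonneg_right h (Real.log_nonneg one_le_two)

lemma add_div_one_sub_two_mul_le {I h e c : ℝ} (hI : 0 ≤ I) (hh : 0 ≤ h) (he : 0 ≤ e)
    (hec : e ≤ c) (hc : c < 1 / 2) :
    (I + h) / (1 - 2 * e) ≤ I + I * (2 * e) / (1 - 2 * c) + h / (1 - 2 * c) := by
  have hc' : 0 < 1 - 2 * c := by linarith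
  have hle : 1 - 2 * c ≤ 1 - 2 * e := by linarith
  have he' : 0 < 1 - 2 * e := hc'.trans_le hle
  calc (I + h) / (1 - 2 * e)
      = I + I * (2 * e) / (1 - 2 * e) + h / (1 - 2 * e) := by field_simp; ring
    _ ≤ _ := by gcongr

/-- Arithmetic content of Theorem 1: given the counting bound of Lemma 1 with
noise parameter `I ≥ 0`, gate size `g > 0`, `d ≥ g/2`, `G ≥ 2`, `G ≥ d/g`,
`N ≥ (G-1)·g` and `0 < c ≤ 1/4`, if there exist `ε₁,…,ε_G ∈ [0,1/2)` with
`∑ εᵢ ≤ c` and `d ≤ ∑ (I + h₂(εᵢ))/(1-2εᵢ)`, then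
`N ≥ (d - I/(1-2c)) / (I/g + (G/(g·(G-1)))·h₂(g·c/d)/(1-2c))`. -/
theorem physical_qubits_lower_bound (G : ℕ) (g d N I c : ℝ)
    (hg : 0 < g) (hd : d ≥ g / 2) (hG2 : (G : ℝ) ≥ 2) (hGdg : (G : ℝ) ≥ d / g)
    (hN : N ≥ ((G : ℝ) - 1) * g) (hI : 0 ≤ I) (hc0 : 0 < c) (hc : c ≤ 1 / 4)
    (ε : Fin G → ℝ) (hε0 : ∀ i, 0 ≤ ε i) (hε1 : ∀ i, ε i < 1 / 2)
    (hsum : ∑ i, ε i ≤ c)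
    (hdle : d ≤ ∑ i, (I + binEnt (ε i)) / (1 - 2 * ε i)) :
    N ≥ (d - I / (1 - 2 * c)) /
        (I / g + (G : ℝ) / (g * ((G : ℝ) - 1)) * binEnt (g * c / d) / (1 - 2 * c)) := by
  have hGpos : (0 : ℝ) < G := by linarith
  have hG1 : (0 : ℝ) < (G : ℝ) - 1 := by linarith
  have hdpos : 0 < d := by linarith
  have hc' : 0 < 1 - 2 * c := by linarith
  have hx0 : 0 < g * c / d := by positivity
  have hx1 : g * c / d ≤ 1 / 2 := by
    rw [div_le_iff₀ hdpos]
    nlinarith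
  have hεc : ∀ i, ε i ≤ c := fun i =>
    (Finset.single_le_sum (fun j _ => hε0 j) (Finset.mem_univ i)).trans hsum
  have hmean : (∑ i, ε i) / G ≤ g * c / d := by
    rw [ge_iff_le, div_le_iff₀ hg] at hGdg
    rw [div_le_div_iff₀ hGpos hdpos]
    nlinarith
  have hent : ∑ i, binEnt (ε i) ≤ G * binEnt (g * c / d) :=
    (sum_binEnt_le (by exact_mod_cast hGpos) ε hε0 fun i => by linarith [hε1 i]).trans
      (mul_le_mul_of_nonneg_left (binEnt_le_binEnt
        (div_nonneg (Finset.sum_nonneg fun i _ => hε0 i) hGpos.le) hmean hx1) hGpos.le)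
  have hpos : 0 < I / g + (G : ℝ) / (g * ((G : ℝ) - 1)) * binEnt (g * c / d) / (1 - 2 * c) := by
    have := binEnt_pos hx0 (by linarith)
    positivity
  rw [ge_iff_le, div_le_iff₀ hpos]
  have hbound : d ≤ G * I + I * (2 * c) / (1 - 2 * c)
      + G * binEnt (g * c / d) / (1 - 2 * c) := by
    calc d ≤ ∑ i, (I + binEnt (ε i)) / (1 - 2 * ε i) := hdle
      _ ≤ ∑ i, (I + I * (2 * ε i) / (1 - 2 * c) + binEnt (ε i) / (1 - 2 * c)) :=
          Finset.sum_le_sum fun i _ => add_div_one_sub_two_mul_le hI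
            (binEnt_nonneg (hε0 i) (by linarith [hε1 i])) (hε0 i) (hεc i) (by linarith)
      _ = G * I + I * (2 * ∑ i, ε i) / (1 - 2 * c) + (∑ i, binEnt (ε i)) / (1 - 2 * c) := by
          simp [Finset.sum_add_distrib, ← Finset.sum_div, ← Finset.mul_sum]
      _ ≤ _ := by gcongr
  calc d - I / (1 - 2 * c)
      ≤ G * I + I * (2 * c) / (1 - 2 * c) + G * binEnt (g * c / d) / (1 - 2 * c)
          - I / (1 - 2 * c) := by linarith
    _ = ((G : ℝ) - 1) * g *
          (I / g + (G : ℝ) / (g * ((G : ℝ) - 1)) * binEnt (g * c / d) / (1 - 2 * c)) := by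
        field_simp
        ring
    _ ≤ _ := mul_le_mul_of_nonneg_right hN hpos.le
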